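/- Let L > 0, set λ = (2π/L)⁴, and let τ > 0. Let g : ℝ → ℝ be a continuous L-periodic function, let v₀, v₁ be twice continuously differentiable L-periodic mean-zero functions, and for t ∈ [0,1] set v_t = (1−t)v₀ + t v₁. Then the Moreau–Yosida functional Φ(τ, g; v) = φ(v) + (1/(2τ)) ∫₀ᴸ (g − v)² dx satisfies the (τ⁻¹ + λ)-convexity inequality Φ(τ, g; v_t) ≤ (1−t)Φ(τ, g; v₀) + t Φ(τ, g; v₁) − (1/2)(1/τ + λ) t(1−t) ∫₀ᴸ (v₀ − v₁)² dx for all t ∈ [0,1]. -/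

import Mathlib

open MeasureTheory Set

/-- `cosh` is strongly convex with modulus `1`. -/
theorem strongConvexOn_cosh : StrongConvexOn univ 1 Real.cosh := by
  rw [strongConvexOn_iff_convex]
  have hd : ∀ x, HasDerivAt (fun x : ℝ => Real.cosh x - 1 / 2 * ‖x‖ ^ 2) (Real.sinh x - x) x := by
    intro x
    have h := (Real.hasDerivAt_cosh x).sub (((hasDerivAt_id x).pow 2).const_mul (1 / 2 : ℝ))
    simp only [Real.norm_eq_abs, sq_abs]
    exact h.congr_deriv (by simp)
  have hd' : deriv (fun x : ℝ => Real.cosh x - 1 / 2 * ‖x‖ ^ 2) = fun x => Real.sinh x - x :=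
    funext fun x => (hd x).deriv
  have hd2 : ∀ x, HasDerivAt (fun x : ℝ => Real.sinh x - x) (Real.cosh x - 1) x := fun x =>
    (Real.hasDerivAt_sinh x).sub (hasDerivAt_id x)
  refine convexOn_univ_of_deriv2_nonneg (fun x => (hd x).differentiableAt) ?_ fun x => ?_
  · rw [hd']
    exact fun x => (hd2 x).differentiableAt
  · rw [Function.iterate_succ_apply, Function.iterate_one, hd', (hd2 x).deriv]
    linarith [Real.one_le_cosh x]

/-- **Wirtinger's inequality**: a mean-zero `C¹` function taking equal values at the endpoints of
`[a, b]` satisfies `(2π / (b - a))² ∫ f² ≤ ∫ f'²`. -/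
theorem wirtinger_inequality {a b : ℝ} (hab : a < b) {f f' : ℝ → ℝ}
    (hf : ∀ x, HasDerivAt f (f' x) x) (hf' : Continuous f') (hend : f a = f b)
    (hmean : ∫ x in a..b, f x = 0) :
    (2 * Real.pi / (b - a)) ^ 2 * ∫ x in a..b, f x ^ 2 ≤ ∫ x in a..b, f' x ^ 2 := by
  have hba : 0 < b - a := sub_pos.2 hab
  have hfc : Continuous f := continuous_iff_continuousAt.2 fun x => (hf x).continuousAt
  have parseval : ∀ h : ℝ → ℝ, Continuous h →
      HasSum (fun n => ‖fourierCoeffOn hab (fun x => (h x : ℂ)) n‖ ^ 2)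
        ((b - a)⁻¹ * ∫ x in a..b, h x ^ 2) := by
    intro h hh
    have hc : Continuous fun x => (h x : ℂ) := Complex.continuous_ofReal.comp hh
    have hmem : MemLp (fun x => (h x : ℂ)) 2 (volume.restrict (Ioc a b)) :=
      ((memLp_two_iff_integrable_sq_norm hc.aestronglyMeasurable).2
        (((hc.norm.pow 2).integrableOn_Icc).mono_set Ioc_subset_Icc_self))
    simpa using hasSum_sq_fourierCoeffOn hab hmem
  have hcoeff : ∀ n : ℤ, (2 * Real.pi / (b - a)) ^ 2 *
      ‖fourierCoeffOn hab (fun x => (f x : ℂ)) n‖ ^ 2 ≤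
        ‖fourierCoeffOn hab (fun x => (f' x : ℂ)) n‖ ^ 2 := by
    intro n
    rcases eq_or_ne n 0 with rfl | hn
    · have h0 : fourierCoeffOn hab (fun x => (f x : ℂ)) 0 = 0 := by
        rw [fourierCoeffOn_eq_integral]
        simp [intervalIntegral.integral_ofReal, hmean]
      rw [h0]
      simp
    · have h := fourierCoeffOn_of_hasDerivAt hab (f := fun x => (f x : ℂ))
        (f' := fun x => (f' x : ℂ)) hn (fun x _ => (hf x).ofReal_comp)
        ((Complex.continuous_ofReal.comp hf').intervalIntegrable a b)
      have hnorm : 2 * Real.pi * |(n : ℝ)| * ‖fourierCoeffOn hab (fun x => (f x : ℂ)) n‖ =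
          (b - a) * ‖fourierCoeffOn hab (fun x => (f' x : ℂ)) n‖ := by
        have hn' : (n : ℝ) ≠ 0 := Int.cast_ne_zero.2 hn
        have hba' : ‖(b : ℂ) - a‖ = b - a := by
          rw [← Complex.ofReal_sub, Complex.norm_real, Real.norm_of_nonneg hba.le]
        rw [h, hend, sub_self, mul_zero, zero_sub, norm_mul, norm_neg, norm_mul, hba']
        simp only [norm_div, norm_mul, norm_neg, norm_one, Complex.norm_real, Complex.norm_I,
          Complex.norm_intCast, Complex.norm_ofNat, Real.norm_of_nonneg Real.pi_pos.le]
        have := Real.pi_pos.ne'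
        field_simp
      have hn1 : (1 : ℝ) ≤ |(n : ℝ)| := by exact_mod_cast Int.one_le_abs hn
      rw [← mul_pow]
      refine pow_le_pow_left₀ (by positivity) ?_ 2
      rw [div_mul_eq_mul_div, div_le_iff₀ hba, mul_comm _ (b - a), ← hnorm]
      exact mul_le_mul_of_nonneg_right (le_mul_of_one_le_right Real.two_pi_pos.le hn1)
        (norm_nonneg _)
  have h := hasSum_le hcoeff ((parseval f hfc).mul_left _) (parseval f' hf')
  rw [mul_left_comm] at h
  exact le_of_mul_le_mul_left h (inv_pos.2 hba)

/-- The derivative of a periodic function is periodic. -/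
theorem Function.Periodic.deriv_periodic {f : ℝ → ℝ} {c : ℝ} (hf : Function.Periodic f c) :
    Function.Periodic (deriv f) c := by
  intro x
  rw [← deriv_comp_add_const, funext hf]

/-- The second-order Wirtinger inequality for mean-zero periodic functions. -/
theorem wirtinger_inequality_deriv_deriv {L : ℝ} (hL : 0 < L) {w : ℝ → ℝ} (hw : ContDiff ℝ 2 w)
    (hp : Function.Periodic w L) (hmean : ∫ x in (0 : ℝ)..L, w x = 0) :
    (2 * Real.pi / L) ^ 4 * ∫ x in (0 : ℝ)..L, w x ^ 2 ≤
      ∫ x in (0 : ℝ)..L, deriv (deriv w) x ^ 2 := by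
  have hw1 : ContDiff ℝ 1 (deriv w) := hw.deriv'
  have hd : ∀ x, HasDerivAt w (deriv w x) x := fun x =>
    (hw.differentiable (by norm_num) x).hasDerivAt
  have hd1 : ∀ x, HasDerivAt (deriv w) (deriv (deriv w) x) x := fun x =>
    (hw1.differentiable (by norm_num) x).hasDerivAt
  have hend : w 0 = w L := by simpa using (hp 0).symm
  have hend1 : deriv w 0 = deriv w L := by simpa using (hp.deriv_periodic 0).symm
  have hmean1 : ∫ x in (0 : ℝ)..L, deriv w x = 0 := by
    rw [intervalIntegral.integral_eq_sub_of_hasDerivAt (fun x _ => hd x)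
      (hw1.continuous.intervalIntegrable _ _), hend, sub_self]
  have h0 := wirtinger_inequality hL hd hw1.continuous hend hmean
  have h1 := wirtinger_inequality hL hd1 (hw1.continuous_deriv le_rfl) hend1 hmean1
  rw [sub_zero] at h0 h1
  calc (2 * Real.pi / L) ^ 4 * ∫ x in (0 : ℝ)..L, w x ^ 2
      = (2 * Real.pi / L) ^ 2 * ((2 * Real.pi / L) ^ 2 * ∫ x in (0 : ℝ)..L, w x ^ 2) := by ring
    _ ≤ (2 * Real.pi / L) ^ 2 * ∫ x in (0 : ℝ)..L, deriv w x ^ 2 := by gcongr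
    _ ≤ _ := h1

/-- (τ⁻¹ + λ)-convexity of the Moreau–Yosida functional
Φ(τ, g; v) = φ(v) + (1/(2τ)) ∫₀ᴸ (g − v)², where φ(v) = ∫₀ᴸ cosh(v'')
and λ = (2π/L)⁴. -/
theorem moreau_yosida_convexity
    (L : ℝ) (hL : 0 < L) (τ : ℝ) (hτ : 0 < τ)
    (g : ℝ → ℝ) (hg : Continuous g) (hgp : Function.Periodic g L)
    (v₀ v₁ : ℝ → ℝ)
    (hv₀ : ContDiff ℝ 2 v₀) (hv₀p : Function.Periodic v₀ L)
    (hv₀m : ∫ x in (0:ℝ)..L, v₀ x = 0)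
    (hv₁ : ContDiff ℝ 2 v₁) (hv₁p : Function.Periodic v₁ L)
    (hv₁m : ∫ x in (0:ℝ)..L, v₁ x = 0)
    (t : ℝ) (ht : t ∈ Set.Icc (0:ℝ) 1) :
    ((∫ x in (0:ℝ)..L,
        Real.cosh (deriv (deriv (fun y => (1 - t) * v₀ y + t * v₁ y)) x))
      + (1 / (2 * τ)) * ∫ x in (0:ℝ)..L,
          (g x - ((1 - t) * v₀ x + t * v₁ x)) ^ 2)
    ≤ (1 - t) * ((∫ x in (0:ℝ)..L, Real.cosh (deriv (deriv v₀) x))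
          + (1 / (2 * τ)) * ∫ x in (0:ℝ)..L, (g x - v₀ x) ^ 2)
      + t * ((∫ x in (0:ℝ)..L, Real.cosh (deriv (deriv v₁) x))
          + (1 / (2 * τ)) * ∫ x in (0:ℝ)..L, (g x - v₁ x) ^ 2)
      - (1 / 2) * (1 / τ + (2 * Real.pi / L) ^ 4) * t * (1 - t)
          * ∫ x in (0:ℝ)..L, (v₀ x - v₁ x) ^ 2 := by
  have hd : ∀ {v : ℝ → ℝ}, ContDiff ℝ 2 v → Differentiable ℝ v := fun hv =>
    hv.differentiable (by norm_num)
  have hd1 : ∀ {v : ℝ → ℝ}, ContDiff ℝ 2 v → ContDiff ℝ 1 (deriv v) := fun hv => hv.deriv'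
  have hd' : ∀ {v : ℝ → ℝ}, ContDiff ℝ 2 v → Differentiable ℝ (deriv v) := fun hv =>
    (hd1 hv).differentiable (by norm_num)
  have hcont : ∀ {v : ℝ → ℝ}, ContDiff ℝ 2 v → Continuous (deriv (deriv v)) := fun hv =>
    (hd1 hv).continuous_deriv le_rfl
  have hdd : ∀ (α β : ℝ) (x : ℝ), deriv (deriv (fun y => α * v₀ y + β * v₁ y)) x =
      α * deriv (deriv v₀) x + β * deriv (deriv v₁) x := by
    intro α β x
    have h1 : deriv (fun y => α * v₀ y + β * v₁ y) = fun y => α * deriv v₀ y + β * deriv v₁ y :=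
      funext fun y => (((hd hv₀ y).hasDerivAt.const_mul α).add
        ((hd hv₁ y).hasDerivAt.const_mul β)).deriv
    rw [h1]
    exact (((hd' hv₀ x).hasDerivAt.const_mul α).add ((hd' hv₁ x).hasDerivAt.const_mul β)).deriv
  have hc₀ := hcont hv₀
  have hc₁ := hcont hv₁
  have hv₀c := hv₀.continuous
  have hv₁c := hv₁.continuous
  have hcosh : (∫ x in (0:ℝ)..L,
        Real.cosh (deriv (deriv (fun y => (1 - t) * v₀ y + t * v₁ y)) x)) ≤
      (1 - t) * (∫ x in (0:ℝ)..L, Real.cosh (deriv (deriv v₀) x)) +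
        t * (∫ x in (0:ℝ)..L, Real.cosh (deriv (deriv v₁) x)) -
        1 / 2 * t * (1 - t) *
          ∫ x in (0:ℝ)..L, (deriv (deriv v₀) x - deriv (deriv v₁) x) ^ 2 := by
    simp_rw [hdd]
    rw [← intervalIntegral.integral_const_mul, ← intervalIntegral.integral_const_mul,
      ← intervalIntegral.integral_const_mul, ← intervalIntegral.integral_add,
      ← intervalIntegral.integral_sub]
    · refine intervalIntegral.integral_mono_on hL.le ?_ ?_ fun x _ => ?_
      · exact Continuous.intervalIntegrable (by fun_prop) _ _
      · exact Continuous.intervalIntegrable (by fun_prop) _ _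
      · have h := strongConvexOn_cosh.2 (mem_univ (deriv (deriv v₀) x))
          (mem_univ (deriv (deriv v₁) x)) (sub_nonneg.2 ht.2) ht.1 (sub_add_cancel 1 t)
        simp only [smul_eq_mul, Real.norm_eq_abs, sq_abs] at h
        linarith
    all_goals exact Continuous.intervalIntegrable (by fun_prop) _ _
  have hquad : (∫ x in (0:ℝ)..L, (g x - ((1 - t) * v₀ x + t * v₁ x)) ^ 2) =
      (1 - t) * (∫ x in (0:ℝ)..L, (g x - v₀ x) ^ 2) + t * (∫ x in (0:ℝ)..L, (g x - v₁ x) ^ 2) -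
        t * (1 - t) * ∫ x in (0:ℝ)..L, (v₀ x - v₁ x) ^ 2 := by
    rw [← intervalIntegral.integral_const_mul, ← intervalIntegral.integral_const_mul,
      ← intervalIntegral.integral_const_mul, ← intervalIntegral.integral_add,
      ← intervalIntegral.integral_sub]
    · congr 1
      funext x
      ring
    all_goals exact Continuous.intervalIntegrable (by fun_prop) _ _
  have hwirt := wirtinger_inequality_deriv_deriv hL (hv₀.sub hv₁) (hv₀p.sub hv₁p) (by
    rw [intervalIntegral.integral_sub (hv₀c.intervalIntegrable _ _)
      (hv₁c.intervalIntegrable _ _), hv₀m, hv₁m, sub_zero])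
  have hsub : ∀ x, deriv (deriv fun y => v₀ y - v₁ y) x = deriv (deriv v₀) x - deriv (deriv v₁) x := by
    intro x
    have h := hdd 1 (-1) x
    simp only [one_mul, neg_one_mul, ← sub_eq_add_neg] at h
    exact h
  simp only [hsub] at hwirt
  have hgap := mul_le_mul_of_nonneg_left hwirt
    (mul_nonneg (mul_nonneg one_half_pos.le ht.1) (sub_nonneg.2 ht.2))
  rw [hquad]
  have hτ2 : 1 / (2 * τ) = 1 / 2 * (1 / τ) := by rw [one_div_mul_one_div]
  rw [hτ2]
  linarith
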